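/- arXiv:2410.07352 — 6 statements merged into one kernel-verified Lean document; each statement's English description precedes it below -/
import Mathlib

section
/- Let I and J be finite index sets, let Λ : I × J → ℝ_{>0}, and let a : I → ℝ_{>0}, b : J → ℝ_{>0}. Define Λ'_{ij} = a_i · b_j · Λ_{ij}. Fix row sums r and column sums c with Σ_i r_i = Σ_j c_j and let F(r,c) be the fiber of nonnegative integer tables with these margins. Then the probability distributions on F(r,c) proportional to t ↦ Π_{i,j} Λ_{ij}^{t_{ij}} / t_{ij}! and to t ↦ Π_{i,j} (Λ'_{ij})^{t_{ij}} / t_{ij}! are equal; that is, the doubly-constrained conditional table distribution is invariant under rescaling Λ_{ij} ↦ a_i b_j Λ_{ij}, and hence depends on Λ only through its odds ratios ω_{ij} = Λ_{ij} Λ_{++} / (Λ_{i+} Λ_{+j}). -/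
/-- **The doubly-constrained conditional table distribution is invariant under
`Λ_{ij} ↦ a_i b_j Λ_{ij}`.** Fix margins `r, c` with `∑ r = ∑ c` and a nonempty fiber
`F(r,c)` of nonnegative integer tables with these margins. The probability distributions
on `F(r,c)` proportional to `t ↦ ∏ Λ^t/t!` and to `t ↦ ∏ (aᵢbⱼΛ)^t/t!` coincide; hence
the distribution depends on `Λ` only through its odds ratios. -/
theorem doubly_constrained_distribution_invariant_under_margin_rescaling
    {I J : Type*} [Fintype I] [Fintype J]
    (Λ : I × J → ℝ) (hΛ : ∀ p, 0 < Λ p)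
    (a : I → ℝ) (ha : ∀ i, 0 < a i) (b : J → ℝ) (hb : ∀ j, 0 < b j)
    (r : I → ℕ) (c : J → ℕ) (hrc : ∑ i, r i = ∑ j, c j)
    (hne : ∃ t0 : I × J → ℕ,
      (∀ i, ∑ j, t0 (i, j) = r i) ∧ (∀ j, ∑ i, t0 (i, j) = c j))
    (t : I × J → ℕ)
    (htr : ∀ i, ∑ j, t (i, j) = r i) (htc : ∀ j, ∑ i, t (i, j) = c j) :
    (∏ p, Λ p ^ t p / ((t p).factorial : ℝ)) /
        (∑' t' : {s : I × J → ℕ //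
            (∀ i, ∑ j, s (i, j) = r i) ∧ (∀ j, ∑ i, s (i, j) = c j)},
          ∏ p, Λ p ^ t'.1 p / ((t'.1 p).factorial : ℝ))
      = (∏ p, (a p.1 * b p.2 * Λ p) ^ t p / ((t p).factorial : ℝ)) /
        (∑' t' : {s : I × J → ℕ //
            (∀ i, ∑ j, s (i, j) = r i) ∧ (∀ j, ∑ i, s (i, j) = c j)},
          ∏ p, (a p.1 * b p.2 * Λ p) ^ t'.1 p / ((t'.1 p).factorial : ℝ)) := by
  have key : ∀ s : I × J → ℕ, (∀ i, ∑ j, s (i, j) = r i) → (∀ j, ∑ i, s (i, j) = c j) →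
      ∏ p, (a p.1 * b p.2 * Λ p) ^ s p / ((s p).factorial : ℝ)
        = ((∏ i, a i ^ r i) * ∏ j, b j ^ c j) * ∏ p, Λ p ^ s p / ((s p).factorial : ℝ) := by
    intro s hr hc
    have h1 : ∏ p : I × J, a p.1 ^ s p = ∏ i, a i ^ r i := by
      rw [Fintype.prod_prod_type]
      refine Finset.prod_congr rfl fun i _ => ?_
      rw [← hr i]
      exact Finset.prod_pow_eq_pow_sum Finset.univ (fun j => s (i, j)) (a i)
    have h2 : ∏ p : I × J, b p.2 ^ s p = ∏ j, b j ^ c j := by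
      rw [Fintype.prod_prod_type_right]
      refine Finset.prod_congr rfl fun j _ => ?_
      rw [← hc j]
      exact Finset.prod_pow_eq_pow_sum Finset.univ (fun i => s (i, j)) (b j)
    rw [← h1, ← h2, ← Finset.prod_mul_distrib, ← Finset.prod_mul_distrib]
    refine Finset.prod_congr rfl fun p _ => ?_
    rw [mul_pow, mul_pow, mul_div_assoc]
  have hK : ((∏ i, a i ^ r i) * ∏ j, b j ^ c j) ≠ 0 :=
    (mul_pos (Finset.prod_pos fun i _ => pow_pos (ha i) _)
      (Finset.prod_pos fun j _ => pow_pos (hb j) _)).ne'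
  rw [key t htr htc, tsum_congr (fun t' : {s : I × J → ℕ //
      (∀ i, ∑ j, s (i, j) = r i) ∧ (∀ j, ∑ i, s (i, j) = c j)} => key t'.1 t'.2.1 t'.2.2), tsum_mul_left,
    mul_div_mul_left _ _ hK]
end

section
/- Let I and J be finite index sets and let Λ : I × J → ℝ_{>0} satisfy the independence (rank-one) condition Λ_{ij} = Λ_{i+} Λ_{+j} / Λ_{++} for all (i,j) (equivalently, all odds ratios ω_{ij} equal 1). Fix row sums r and column sums c with N := Σ_i r_i = Σ_j c_j. Then for every table t in the fiber F(r,c), the distribution on F(r,c) proportional to t ↦ Π_{i,j} Λ_{ij}^{t_{ij}} / t_{ij}! assigns to t exactly the central multivariate hypergeometric probability (Π_i r_i! · Π_j c_j!) / (N! · Π_{i,j} t_{ij}!). -/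
open Finset in
lemma coeff_aux {J : Type*} [Fintype J] [DecidableEq J] (f c : J → ℕ) (a : ℝ) :
    MvPolynomial.coeff (Finsupp.equivFunOnFinite.symm c)
      (MvPolynomial.C a * ∏ j, (MvPolynomial.X j : MvPolynomial J ℝ) ^ f j) =
      if f = c then a else 0 := by
  have : (∏ j, (MvPolynomial.X j : MvPolynomial J ℝ) ^ f j) =
      MvPolynomial.monomial (Finsupp.equivFunOnFinite.symm f) 1 := by
    rw [MvPolynomial.monomial_eq, Finsupp.prod_fintype _ _ (by simp)]
    simp
  rw [this, MvPolynomial.coeff_C_mul, MvPolynomial.coeff_monomial]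
  simp [Finsupp.equivFunOnFinite.symm.injective.eq_iff]

lemma multinomial_real {J : Type*} [Fintype J] (f : J → ℕ) (n : ℕ) (h : ∑ j, f j = n) :
    (Nat.multinomial Finset.univ f : ℝ) = n.factorial / ∏ j, ((f j).factorial : ℝ) := by
  have h0 : (∏ j, ((f j).factorial : ℝ)) ≠ 0 :=
    Finset.prod_ne_zero_iff.2 fun j _ => by positivity
  rw [eq_div_iff h0, mul_comm]
  have := Nat.multinomial_spec Finset.univ f
  rw [h] at this
  exact_mod_cast this

open Finset in
lemma fiber_sum {I J : Type*} [Fintype I] [Fintype J] [DecidableEq I] [DecidableEq J]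
    (r : I → ℕ) (c : J → ℕ) (N : ℕ) (hr : ∑ i, r i = N) (hc : ∑ j, c j = N) :
    ∑ k ∈ (Fintype.piFinset fun i => piAntidiag (univ : Finset J) (r i)) with
        (fun j => ∑ i, k i j) = c, ∏ i, ∏ j, (1 / ((k i j).factorial : ℝ)) =
      N.factorial / ((∏ i, ((r i).factorial : ℝ)) * ∏ j, ((c j).factorial : ℝ)) := by
  have key : ∏ i, (∑ j, (MvPolynomial.X j : MvPolynomial J ℝ)) ^ r i =
      (∑ j, (MvPolynomial.X j : MvPolynomial J ℝ)) ^ N := by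
    rw [Finset.prod_pow_eq_pow_sum, hr]
  simp_rw [Finset.sum_pow_eq_sum_piAntidiag] at key
  rw [Finset.prod_univ_sum] at key
  have cast : ∀ n : ℕ, (n : MvPolynomial J ℝ) = MvPolynomial.C (n : ℝ) := by simp
  have e : ∀ k : I → J → ℕ, ∏ i, ((Nat.multinomial univ (k i) : MvPolynomial J ℝ) *
      ∏ j, (MvPolynomial.X j : MvPolynomial J ℝ) ^ k i j) =
      MvPolynomial.C (∏ i, (Nat.multinomial univ (k i) : ℝ)) *
        ∏ j, (MvPolynomial.X j : MvPolynomial J ℝ) ^ (∑ i, k i j) := by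
    intro k
    rw [Finset.prod_mul_distrib, Finset.prod_comm, map_prod]
    simp_rw [Finset.prod_pow_eq_pow_sum, cast]
  simp_rw [e, cast] at key
  have key2 := congrArg (MvPolynomial.coeff (Finsupp.equivFunOnFinite.symm c)) key
  simp_rw [MvPolynomial.coeff_sum] at key2
  simp_rw [coeff_aux (J := J)] at key2
  rw [Finset.sum_ite_eq_of_mem' _ _ _ (by simp [mem_piAntidiag, hc]), multinomial_real c N hc,
    ← Finset.sum_filter] at key2
  have hR : (∏ i, ((r i).factorial : ℝ)) ≠ 0 :=
    Finset.prod_ne_zero_iff.2 fun j _ => by positivity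
  have hC : (∏ j, ((c j).factorial : ℝ)) ≠ 0 :=
    Finset.prod_ne_zero_iff.2 fun j _ => by positivity
  have e2 : ∑ k ∈ (Fintype.piFinset fun i => piAntidiag (univ : Finset J) (r i)) with
        (fun j => ∑ i, k i j) = c, ∏ i, (Nat.multinomial univ (k i) : ℝ) =
      (∏ i, ((r i).factorial : ℝ)) *
      ∑ k ∈ (Fintype.piFinset fun i => piAntidiag (univ : Finset J) (r i)) with
        (fun j => ∑ i, k i j) = c, ∏ i, ∏ j, (1 / ((k i j).factorial : ℝ)) := by
    rw [Finset.mul_sum]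
    refine Finset.sum_congr rfl fun k hk => ?_
    rw [← Finset.prod_mul_distrib]
    refine Finset.prod_congr rfl fun i _ => ?_
    simp only [mem_filter, Fintype.mem_piFinset, mem_piAntidiag] at hk
    rw [multinomial_real (k i) (r i) (hk.1 i).1]
    simp [div_eq_mul_inv]
  rw [e2] at key2
  rw [eq_div_iff (mul_ne_zero hR hC), ← mul_assoc, mul_comm _ (∏ i, ((r i).factorial : ℝ)), key2]
  field_simp


/-- **Under the rank-one (independence) condition on `Λ`, the doubly-constrained table
distribution is the central multivariate hypergeometric.** Suppose
`Λ_{ij} = Λ_{i+} Λ_{+j} / Λ_{++}` for all `(i,j)` (all odds ratios equal `1`). Fix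
margins `r, c` with `N = ∑ r = ∑ c`. Then for every table `t` in the fiber `F(r,c)`,
the distribution on `F(r,c)` proportional to `t ↦ ∏ Λ^t/t!` assigns to `t` the
probability `(∏ r_i! ∏ c_j!) / (N! ∏ t_{ij}!)`. -/
theorem doubly_constrained_rank_one_eq_central_hypergeometric
    {I J : Type*} [Fintype I] [Fintype J]
    (Λ : I × J → ℝ) (hΛ : ∀ p, 0 < Λ p)
    (hrank1 : ∀ i j, Λ (i, j) = (∑ m, Λ (i, m)) * (∑ k, Λ (k, j)) / ∑ q, Λ q)
    (r : I → ℕ) (c : J → ℕ) (N : ℕ) (hr : ∑ i, r i = N) (hc : ∑ j, c j = N)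
    (t : I × J → ℕ)
    (htr : ∀ i, ∑ j, t (i, j) = r i) (htc : ∀ j, ∑ i, t (i, j) = c j) :
    (∏ p, Λ p ^ t p / ((t p).factorial : ℝ)) /
        (∑' t' : {s : I × J → ℕ //
            (∀ i, ∑ j, s (i, j) = r i) ∧ (∀ j, ∑ i, s (i, j) = c j)},
          ∏ p, Λ p ^ t'.1 p / ((t'.1 p).factorial : ℝ))
      = ((∏ i, ((r i).factorial : ℝ)) * ∏ j, ((c j).factorial : ℝ)) /
          ((N.factorial : ℝ) * ∏ p, ((t p).factorial : ℝ)) := by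
  classical
  set K : ℝ := (∏ i, (∑ m, Λ (i, m)) ^ r i) * (∏ j, (∑ k, Λ (k, j)) ^ c j) / (∑ q, Λ q) ^ N
    with hK
  have hw : ∀ s : I × J → ℕ, (∀ i, ∑ j, s (i, j) = r i) → (∀ j, ∑ i, s (i, j) = c j) →
      ∏ p, Λ p ^ s p = K := by
    intro s h1 h2
    rw [Fintype.prod_prod_type]
    have : ∀ i j, Λ (i, j) ^ s (i, j) = (∑ m, Λ (i, m)) ^ s (i, j) *
        (∑ k, Λ (k, j)) ^ s (i, j) / (∑ q, Λ q) ^ s (i, j) := by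
      intro i j
      rw [← mul_pow, ← div_pow, ← hrank1]
    simp_rw [this, Finset.prod_div_distrib, Finset.prod_mul_distrib]
    rw [Finset.prod_comm (f := fun i j => (∑ k, Λ (k, j)) ^ s (i, j))]
    simp_rw [Finset.prod_pow_eq_pow_sum, h1, h2, hr]
    rfl
  have hKpos : 0 < K := by
    rw [← hw t htr htc]
    exact Finset.prod_pos fun p _ => pow_pos (hΛ p) _
  let F := (Fintype.piFinset fun i => Finset.piAntidiag (Finset.univ : Finset J) (r i)).filter
    (fun k => (fun j => ∑ i, k i j) = c)
  have hmem : ∀ s : I × J → ℕ, ((∀ i, ∑ j, s (i, j) = r i) ∧ (∀ j, ∑ i, s (i, j) = c j)) ↔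
      Equiv.curry I J ℕ s ∈ F := by
    intro s
    simp [F, Finset.mem_piAntidiag, funext_iff]
    exact fun _ => Iff.rfl
  have hsum : (∑' t' : {s : I × J → ℕ //
            (∀ i, ∑ j, s (i, j) = r i) ∧ (∀ j, ∑ i, s (i, j) = c j)},
          ∏ p, Λ p ^ t'.1 p / ((t'.1 p).factorial : ℝ)) =
      K * (N.factorial / ((∏ i, ((r i).factorial : ℝ)) * ∏ j, ((c j).factorial : ℝ))) := by
    rw [← fiber_sum r c N hr hc, Finset.mul_sum]
    rw [← Finset.tsum_subtype F
      (fun k => K * ∏ i, ∏ j, (1 / ((k i j).factorial : ℝ)))]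
    rw [← ((Equiv.curry I J ℕ).subtypeEquiv hmem).tsum_eq]
    refine tsum_congr fun s => ?_
    rw [Finset.prod_div_distrib, hw s.1 s.2.1 s.2.2, div_eq_mul_one_div, Fintype.prod_prod_type]
    simp
  rw [hsum, Finset.prod_div_distrib, hw t htr htc]
  have hT : (∏ p, ((t p).factorial : ℝ)) ≠ 0 :=
    Finset.prod_ne_zero_iff.2 fun j _ => by positivity
  have hR : (∏ i, ((r i).factorial : ℝ)) ≠ 0 :=
    Finset.prod_ne_zero_iff.2 fun j _ => by positivity
  have hC : (∏ j, ((c j).factorial : ℝ)) ≠ 0 :=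
    Finset.prod_ne_zero_iff.2 fun j _ => by positivity
  have hN : (N.factorial : ℝ) ≠ 0 := by positivity
  have hK0 := hKpos.ne'
  clear_value K
  field_simp
end

section
/- Let I and J be finite index sets and let T and T' be nonnegative integer I × J tables with the same row sums and the same column sums. Then there exists a finite sequence of swap moves with η = ±1 transforming T into T' such that every intermediate table in the sequence is nonnegative (and hence has the same row and column sums as T). In other words, the set of unit swap moves connects the fiber of nonnegative integer tables with fixed row and column sums. -/
/-- **Unit swap moves connect the fiber of nonnegative integer tables with fixed
margins.** If `T` and `T'` are nonnegative integer `I × J` tables with the same row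
sums and the same column sums, then there is a finite sequence of swap moves with
`η = ±1` transforming `T` into `T'` such that every intermediate table is a
nonnegative integer table (hence stays in the fiber). -/
theorem unit_swap_moves_connect_fiber
    {I J : Type*} [Fintype I] [Fintype J] [DecidableEq I] [DecidableEq J]
    (T T' : I × J → ℕ)
    (hrow : ∀ i, ∑ j, T (i, j) = ∑ j, T' (i, j))
    (hcol : ∀ j, ∑ i, T (i, j) = ∑ i, T' (i, j)) :
    ∃ (n : ℕ) (g : ℕ → I × J → ℕ), g 0 = T ∧ g n = T' ∧
      ∀ k < n, ∃ (i₁ i₂ : I) (j₁ j₂ : J) (η : ℤ),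
        i₁ ≠ i₂ ∧ j₁ ≠ j₂ ∧ (η = 1 ∨ η = -1) ∧
        ∀ x : I × J, (g (k + 1) x : ℤ) = (g k x : ℤ) +
          (if x = (i₁, j₁) ∨ x = (i₂, j₂) then η
            else if x = (i₁, j₂) ∨ x = (i₂, j₁) then -η else 0) := by
  obtain ⟨N, hN⟩ : ∃ N, ∑ x, (T x - T' x) ≤ N := ⟨_, le_rfl⟩
  induction N generalizing T with
  | zero =>
    refine ⟨0, fun _ => T, rfl, ?_, by simp⟩
    have hle : ∀ x, T x ≤ T' x := by
      intro x
      have h1 := Finset.single_le_sum (f := fun x => T x - T' x) (fun _ _ => Nat.zero_le _)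
        (Finset.mem_univ x)
      omega
    funext ⟨i, j⟩
    exact (Finset.sum_eq_sum_iff_of_le (fun j _ => hle (i, j))).1 (hrow i) j (Finset.mem_univ j)
  | succ N ih =>
    by_cases hle : ∀ x, T x ≤ T' x
    · refine ⟨0, fun _ => T, rfl, ?_, by simp⟩
      funext ⟨i, j⟩
      exact (Finset.sum_eq_sum_iff_of_le (fun j _ => hle (i, j))).1 (hrow i) j (Finset.mem_univ j)
    push Not at hle
    obtain ⟨⟨i₁, j₁⟩, h11⟩ := hle
    obtain ⟨i₂, h21⟩ : ∃ i₂, T (i₂, j₁) < T' (i₂, j₁) := by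
      by_contra! h
      have := (Finset.sum_eq_sum_iff_of_le (fun i _ => h i)).1 (hcol j₁).symm i₁
        (Finset.mem_univ _)
      omega
    obtain ⟨j₂, h22⟩ : ∃ j₂, T' (i₂, j₂) < T (i₂, j₂) := by
      by_contra! h
      have := (Finset.sum_eq_sum_iff_of_le (fun j _ => h j)).1 (hrow i₂) j₁
        (Finset.mem_univ _)
      omega
    have hi : i₁ ≠ i₂ := by rintro rfl; omega
    have hj : j₁ ≠ j₂ := by rintro rfl; omega
    obtain ⟨S, hS⟩ : ∃ S : I × J → ℕ, S = fun x =>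
        if x = (i₁, j₁) ∨ x = (i₂, j₂) then T x - 1
        else if x = (i₁, j₂) ∨ x = (i₂, j₁) then T x + 1 else T x := ⟨_, rfl⟩
    have hSm : ∀ x : I × J, (S x : ℤ) = (T x : ℤ) +
          (if x = (i₁, j₁) ∨ x = (i₂, j₂) then (-1 : ℤ)
            else if x = (i₁, j₂) ∨ x = (i₂, j₁) then -(-1 : ℤ) else 0) := by
      intro x
      rw [hS]
      dsimp only
      split_ifs with h1 h2
      · have : 1 ≤ T x := by rcases h1 with rfl | rfl <;> omega
        omega
      · omega
      · omega
    have hSp : ∀ i j, (S (i, j) : ℤ) = (T (i, j) : ℤ) -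
        ((if i = i₁ then 1 else 0) - (if i = i₂ then 1 else 0)) *
        ((if j = j₁ then 1 else 0) - (if j = j₂ then 1 else 0)) := by
      intro i j
      rw [hSm]
      simp only [Prod.mk.injEq]
      clear * - hi hj
      by_cases a : i = i₁ <;> by_cases b : i = i₂ <;> by_cases c : j = j₁ <;>
        by_cases d : j = j₂ <;> grind
    have hr : ∀ i, ∑ j, S (i, j) = ∑ j, T' (i, j) := by
      intro i
      rw [← hrow i]
      zify
      simp only [hSp, Finset.sum_sub_distrib, ← Finset.mul_sum]
      simp
    have hc : ∀ j, ∑ i, S (i, j) = ∑ i, T' (i, j) := by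
      intro j
      rw [← hcol j]
      zify
      simp only [hSp, Finset.sum_sub_distrib, ← Finset.sum_mul]
      simp
    have hdec : ∑ x, (S x - T' x) ≤ N := by
      have hp : ∀ x : I × J, (S x - T' x) + ((if x = (i₁, j₁) then 1 else 0) +
          (if x = (i₂, j₂) then 1 else 0)) ≤ (T x - T' x) + (if x = (i₁, j₂) then 1 else 0) := by
        intro x
        have hx := hSm x
        clear * - hi hj h11 h21 h22 hx
        by_cases a : x = (i₁, j₁)
        · subst a; grind
        by_cases b : x = (i₂, j₂)
        · subst b; grind
        by_cases c : x = (i₁, j₂)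
        · subst c; grind
        by_cases d : x = (i₂, j₁)
        · subst d; grind
        · grind
      have := Finset.sum_le_sum (s := Finset.univ) (fun x _ => hp x)
      simp only [Finset.sum_add_distrib, Finset.sum_ite_eq', Finset.mem_univ, if_true] at this
      omega
    obtain ⟨n, g, g0, gn, hg⟩ := ih S hr hc hdec
    refine ⟨n + 1, fun k => Nat.casesOn k T g, rfl, gn, ?_⟩
    intro k hk
    cases k with
    | zero =>
      refine ⟨i₁, i₂, j₁, j₂, -1, hi, hj, Or.inr rfl, ?_⟩
      intro x
      have := hSm x
      rw [← g0] at this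
      exact this
    | succ k => exact hg k (by omega)
end

section
/- Let S be a nonempty finite set of nonnegative integer tables over a finite cell set X, let μ : S → ℝ_{>0}, and let M = {f₁, …, f_L} be a finite set of moves forming a Markov basis for S: (1) for every l, adding any integer multiple of f_l does not change the defining summary statistics of S, and (2) for any T, T' ∈ S there exist moves f_{l₁}, …, f_{l_A} in M and nonzero integers η₁, …, η_A with T' = T + Σ_{m=1}^{A} η_m f_{l_m} and every partial sum T + Σ_{m=1}^{a} η_m f_{l_m} ∈ S for 1 ≤ a ≤ A. Define the Markov chain on S that, from state T, picks l uniformly from {1,…,L}, then picks η with probability proportional to μ(T + η f_l) over the η with T + η f_l ∈ S, and moves to T + η f_l. Then this chain is reversible with respect to μ, irreducible on S, and aperiodic; hence its unique stationary distribution is proportional to μ. -/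
open scoped Classical

/-- `n`-step transition weights of a kernel `K` on a finite state space `S`. -/
noncomputable def kernelPow {α : Type*} (S : Finset α) (K : α → α → ℝ) :
    ℕ → α → α → ℝ
  | 0 => fun a b => if a = b then 1 else 0
  | n + 1 => fun a b => ∑ c ∈ S, K a c * kernelPow S K n c b

lemma kernelPow_nonneg_aux {α : Type*} (S : Finset α) (K : α → α → ℝ)
    (h0 : ∀ a ∈ S, ∀ b ∈ S, 0 ≤ K a b) (n : ℕ) : ∀ a ∈ S, ∀ b, 0 ≤ kernelPow S K n a b := by
  induction n with
  | zero => intro a _ b; simp only [kernelPow]; split_ifs <;> norm_num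
  | succ n ih =>
    intro a ha b
    simp only [kernelPow]
    exact Finset.sum_nonneg fun c hc => mul_nonneg (h0 a ha c hc) (ih c hc b)

lemma kernelPow_pos_aux {α : Type*} (S : Finset α) (K : α → α → ℝ)
    (h0 : ∀ a ∈ S, ∀ b ∈ S, 0 ≤ K a b) (a b : α)
    (h : Relation.ReflTransGen (fun a b => a ∈ S ∧ b ∈ S ∧ 0 < K a b) a b) :
    ∃ n, 0 < kernelPow S K n a b := by
  induction h using Relation.ReflTransGen.head_induction_on with
  | refl => exact ⟨0, by simp [kernelPow]⟩
  | head h1 h2 ih =>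
    rename_i a c
    obtain ⟨n, hn⟩ := ih
    obtain ⟨ha, hc, hK⟩ := h1
    refine ⟨n + 1, ?_⟩
    simp only [kernelPow]
    exact Finset.sum_pos' (fun c hc => mul_nonneg (h0 a ha c hc)
      (kernelPow_nonneg_aux S K h0 n c hc b)) ⟨c, hc, mul_pos hK hn⟩

lemma harmonic_const_aux {α : Type*} (S : Finset α) (K : α → α → ℝ)
    (h0 : ∀ a ∈ S, ∀ b ∈ S, 0 ≤ K a b) (h1 : ∀ a ∈ S, ∑ b ∈ S, K a b = 1)
    (hc : ∀ a ∈ S, ∀ b ∈ S,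
      Relation.ReflTransGen (fun a b => a ∈ S ∧ b ∈ S ∧ 0 < K a b) a b)
    (hS : S.Nonempty) (g : α → ℝ) (hg : ∀ a ∈ S, ∑ b ∈ S, K a b * g b = g a) :
    ∃ c, ∀ a ∈ S, g a = c := by
  obtain ⟨m, hm, hmax⟩ := S.exists_max_image g hS
  refine ⟨g m, fun a ha => ?_⟩
  have h := hc m hm a ha
  clear ha
  induction h with
  | refl => rfl
  | tail h2 hbc ih =>
    rename_i b c
    obtain ⟨hb, hc', hK⟩ := hbc
    have hsum : ∑ d ∈ S, K b d * (g m - g d) = 0 := by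
      simp only [mul_sub, Finset.sum_sub_distrib]
      rw [← Finset.sum_mul, h1 b hb, hg b hb, ih]; ring
    have := (Finset.sum_eq_zero_iff_of_nonneg (fun d hd =>
      mul_nonneg (h0 b hb d hd) (sub_nonneg.2 (hmax d hd)))).1 hsum c hc'
    rcases mul_eq_zero.1 this with h | h
    · exact absurd h hK.ne'
    · linarith

/-- **The Gibbs Markov-basis sampler is reversible, irreducible and aperiodic, with
unique stationary distribution proportional to `μ`.** Let `S` be a nonempty finite set
of nonnegative integer tables over a finite cell set `X`, cut out by a linear summary
statistic `𝒮` (value `v0`), let `μ` be positive on `S`, and let `f₁, …, f_L` be a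
Markov basis: each move annihilates `𝒮` (Condition 1) and any two tables of `S` are
connected by multiples of moves all of whose partial sums stay in `S` (Condition 2).
The chain that from `T` picks `l` uniformly, then `η` with probability proportional to
`μ(T + η f_l)` over `η ∈ H T l = {η | T + η f_l ∈ S}`, and moves to `T + η f_l`, is
reversible w.r.t. `μ`, irreducible on `S`, aperiodic, and has the probability
distribution proportional to `μ` as its unique stationary distribution. -/
theorem gibbs_markov_basis_sampler_converges
    {X : Type*} [Fintype X] {V : Type*} [AddCommGroup V]
    (𝒮 : ((X → ℤ)) →+ V) (v0 : V)
    (S : Finset (X → ℤ)) (hS : S.Nonempty)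
    (hSdef : ∀ T : X → ℤ, T ∈ S ↔ ((∀ x, 0 ≤ T x) ∧ 𝒮 T = v0))
    (μ : (X → ℤ) → ℝ) (hμ : ∀ T ∈ S, 0 < μ T)
    (L : ℕ) (hL : 0 < L) (f : Fin L → X → ℤ)
    (hcond1 : ∀ l, 𝒮 (f l) = 0)
    (hcond2 : ∀ T ∈ S, ∀ T' ∈ S, ∃ (A : ℕ) (ls : Fin A → Fin L) (η : Fin A → ℤ),
      (∀ m, η m ≠ 0) ∧
      (∀ x, T' x = T x + ∑ m, η m * f (ls m) x) ∧
      (∀ a : ℕ, a ≤ A →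
        (fun x => T x + ∑ m ∈ Finset.univ.filter (fun m : Fin A => (m : ℕ) < a),
          η m * f (ls m) x) ∈ S))
    (H : (X → ℤ) → Fin L → Finset ℤ)
    (hH : ∀ T ∈ S, ∀ (l : Fin L) (η : ℤ),
      η ∈ H T l ↔ (fun x => T x + η * f l x) ∈ S)
    (K : (X → ℤ) → (X → ℤ) → ℝ)
    (hK : ∀ T ∈ S, ∀ T' : X → ℤ,
      K T T' = (1 / L : ℝ) * ∑ l : Fin L,
        (if ∃ η ∈ H T l, T' = fun x => T x + η * f l x
          then μ T' / ∑ η' ∈ H T l, μ (fun x => T x + η' * f l x)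
          else 0)) :
    -- reversibility with respect to μ
    (∀ T ∈ S, ∀ T' ∈ S, μ T * K T T' = μ T' * K T' T) ∧
    -- irreducibility on S
    (∀ T ∈ S, ∀ T' ∈ S, ∃ n : ℕ, 0 < kernelPow S K n T T') ∧
    -- aperiodicity: every state has period one
    (∀ T ∈ S, ∀ d : ℕ,
      (∀ n : ℕ, 0 < n → 0 < kernelPow S K n T T → d ∣ n) → d = 1) ∧
    -- the distribution proportional to μ is stationary
    (∀ T' ∈ S, ∑ T ∈ S, (μ T / ∑ s ∈ S, μ s) * K T T' = μ T' / ∑ s ∈ S, μ s) ∧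
    -- and it is the unique stationary distribution
    (∀ π : (X → ℤ) → ℝ, (∀ T ∈ S, 0 ≤ π T) → (∑ T ∈ S, π T = 1) →
      (∀ T' ∈ S, ∑ T ∈ S, π T * K T T' = π T') →
      ∀ T ∈ S, π T = μ T / ∑ s ∈ S, μ s) := by
  have hLr : (0 : ℝ) < L := by exact_mod_cast hL
  have hf : ∀ l, f l ≠ 0 := by
    intro l hl
    obtain ⟨T, hT⟩ := hS
    obtain ⟨η, hη⟩ := Infinite.exists_notMem_finset (H T l)
    apply hη
    rw [hH T hT]
    simpa [hl] using hT
  let R : Fin L → (X → ℤ) → (X → ℤ) → Prop := fun l T T' => ∃ η : ℤ, T' = fun x => T x + η * f l x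
  have Rrefl : ∀ l T, R l T T := fun l T => ⟨0, by simp⟩
  have Rsymm : ∀ l T T', R l T T' → R l T' T := by
    rintro l T T' ⟨η, rfl⟩
    exact ⟨-η, by funext x; ring⟩
  have Rtrans : ∀ l T T' T'', R l T T' → R l T' T'' → R l T T'' := by
    rintro l T T' T'' ⟨η, rfl⟩ ⟨η', rfl⟩
    exact ⟨η + η', by funext x; ring⟩
  have hRH : ∀ T ∈ S, ∀ T' ∈ S, ∀ l,
      (∃ η ∈ H T l, T' = fun x => T x + η * f l x) ↔ R l T T' := by
    intro T hT T' hT' l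
    constructor
    · rintro ⟨η, _, h⟩; exact ⟨η, h⟩
    · rintro ⟨η, h⟩
      exact ⟨η, (hH T hT l η).2 (h ▸ hT'), h⟩
  let Z : Fin L → (X → ℤ) → ℝ := fun l T => ∑ U ∈ S.filter (fun U => R l T U), μ U
  have hZ : ∀ T ∈ S, ∀ l, ∑ η' ∈ H T l, μ (fun x => T x + η' * f l x) = Z l T := by
    intro T hT l
    refine Finset.sum_bij (fun η _ => fun x => T x + η * f l x) ?_ ?_ ?_ ?_
    · intro η hη
      exact Finset.mem_filter.2 ⟨(hH T hT l η).1 hη, η, rfl⟩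
    · intro η _ η' _ h
      obtain ⟨x, hx⟩ := Function.ne_iff.1 (hf l)
      have := congrFun h x
      exact mul_right_cancel₀ hx (add_left_cancel this)
    · intro U hU
      obtain ⟨hU, η, h⟩ := Finset.mem_filter.1 hU
      exact ⟨η, (hH T hT l η).2 (h ▸ hU), h.symm⟩
    · intro _ _; rfl
  have hZpos : ∀ T ∈ S, ∀ l, 0 < Z l T := by
    intro T hT l
    exact Finset.sum_pos (fun U hU => hμ U (Finset.mem_filter.1 hU).1)
      ⟨T, Finset.mem_filter.2 ⟨hT, Rrefl l T⟩⟩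
  have hZeq : ∀ T T' l, R l T T' → Z l T = Z l T' := by
    intro T T' l h
    have : S.filter (fun U => R l T U) = S.filter (fun U => R l T' U) :=
      Finset.filter_congr fun U _ =>
        ⟨fun h' => Rtrans _ _ _ _ (Rsymm _ _ _ h) h', fun h' => Rtrans _ _ _ _ h h'⟩
    simp only [Z, this]
  have hK' : ∀ T ∈ S, ∀ T' ∈ S,
      K T T' = (1 / L : ℝ) * ∑ l : Fin L, if R l T T' then μ T' / Z l T else 0 := by
    intro T hT T' hT'
    rw [hK T hT]
    congr 1
    refine Finset.sum_congr rfl fun l _ => ?_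
    rw [hZ T hT l]
    simp only [hRH T hT T' hT' l]
  have hterm : ∀ T ∈ S, ∀ T' ∈ S, ∀ l, 0 ≤ if R l T T' then μ T' / Z l T else 0 := by
    intro T hT T' hT' l
    split_ifs
    · exact (div_pos (hμ T' hT') (hZpos T hT l)).le
    · exact le_rfl
  have hK0 : ∀ T ∈ S, ∀ T' ∈ S, 0 ≤ K T T' := by
    intro T hT T' hT'
    rw [hK' T hT T' hT']
    exact mul_nonneg (by positivity) (Finset.sum_nonneg fun l _ => hterm T hT T' hT' l)
  have hKpos : ∀ T ∈ S, ∀ T' ∈ S, ∀ l, R l T T' → 0 < K T T' := by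
    intro T hT T' hT' l h
    rw [hK' T hT T' hT']
    refine mul_pos (by positivity) (Finset.sum_pos' (fun l _ => hterm T hT T' hT' l)
      ⟨l, Finset.mem_univ _, ?_⟩)
    rw [if_pos h]
    exact div_pos (hμ T' hT') (hZpos T hT l)
  have hrow : ∀ T ∈ S, ∑ T' ∈ S, K T T' = 1 := by
    intro T hT
    rw [Finset.sum_congr rfl (fun T' hT' => hK' T hT T' hT'), ← Finset.mul_sum, Finset.sum_comm]
    have : ∀ l ∈ (Finset.univ : Finset (Fin L)),
        ∑ T' ∈ S, (if R l T T' then μ T' / Z l T else 0) = 1 := by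
      intro l _
      rw [← Finset.sum_filter, ← Finset.sum_div]
      exact div_self (hZpos T hT l).ne'
    rw [Finset.sum_congr rfl this]
    simp [hLr.ne']
  have hrev : ∀ T ∈ S, ∀ T' ∈ S, μ T * K T T' = μ T' * K T' T := by
    intro T hT T' hT'
    rw [hK' T hT T' hT', hK' T' hT' T hT, mul_left_comm, mul_left_comm (μ T')]
    congr 1
    rw [Finset.mul_sum, Finset.mul_sum]
    refine Finset.sum_congr rfl fun l _ => ?_
    by_cases h : R l T T'
    · rw [if_pos h, if_pos (Rsymm _ _ _ h), hZeq _ _ _ h]; ring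
    · rw [if_neg h, if_neg (fun h' => h (Rsymm _ _ _ h'))]; simp
  have hconn : ∀ T ∈ S, ∀ T' ∈ S,
      Relation.ReflTransGen (fun a b => a ∈ S ∧ b ∈ S ∧ 0 < K a b) T T' := by
    intro T hT T' hT'
    obtain ⟨A, ls, η, _, hend, hpart⟩ := hcond2 T hT T' hT'
    have key : ∀ a : ℕ, a ≤ A →
        Relation.ReflTransGen (fun a b => a ∈ S ∧ b ∈ S ∧ 0 < K a b) T
        (fun x => T x + ∑ m ∈ Finset.univ.filter (fun m : Fin A => (m : ℕ) < a),
          η m * f (ls m) x) := by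
      intro a
      induction a with
      | zero => intro _; simpa using Relation.ReflTransGen.refl
      | succ a ih =>
        intro ha
        refine (ih (by omega)).tail ⟨hpart a (by omega), hpart (a + 1) ha, ?_⟩
        refine hKpos _ (hpart a (by omega)) _ (hpart (a + 1) ha) (ls ⟨a, ha⟩) ⟨η ⟨a, ha⟩, ?_⟩
        have : Finset.univ.filter (fun m : Fin A => (m : ℕ) < a + 1) =
            insert ⟨a, ha⟩ (Finset.univ.filter (fun m : Fin A => (m : ℕ) < a)) := by
          ext m
          simp only [Finset.mem_filter, Finset.mem_univ, true_and, Finset.mem_insert, Fin.ext_iff]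
          omega
        funext x
        rw [this, Finset.sum_insert (by simp)]
        ring
    have h := key A le_rfl
    have e : (fun x => T x + ∑ m ∈ Finset.univ.filter (fun m : Fin A => (m : ℕ) < A),
          η m * f (ls m) x) = T' := by
      funext x
      rw [hend x, Finset.filter_true_of_mem (fun m _ => m.2)]
    rwa [e] at h
  have hM : 0 < ∑ s ∈ S, μ s := Finset.sum_pos hμ hS
  refine ⟨hrev, fun T hT T' hT' => kernelPow_pos_aux S K hK0 T T' (hconn T hT T' hT'), ?_, ?_, ?_⟩
  · intro T hT d hd
    refine Nat.dvd_one.1 (hd 1 one_pos ?_)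
    have : kernelPow S K 1 T T = K T T := by
      simp [kernelPow, hT]
    rw [this]
    exact hKpos T hT T hT ⟨0, hL⟩ (Rrefl _ _)
  · intro T' hT'
    have : ∀ T ∈ S, (μ T / ∑ s ∈ S, μ s) * K T T' = (μ T' / ∑ s ∈ S, μ s) * K T' T := by
      intro T hT
      rw [div_mul_eq_mul_div, hrev T hT T' hT', div_mul_eq_mul_div]
    rw [Finset.sum_congr rfl this, ← Finset.mul_sum, hrow T' hT', mul_one]
  · intro π _ hπ1 hstat
    obtain ⟨c, hc⟩ := harmonic_const_aux S K hK0 hrow hconn hS (fun T => π T / μ T) (by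
      intro T' hT'
      have : ∀ T ∈ S, K T' T * (π T / μ T) = π T * K T T' / μ T' := by
        intro T hT
        have h1 := (hμ T hT).ne'
        have h2 := (hμ T' hT').ne'
        have h3 := hrev T hT T' hT'
        field_simp
        linear_combination (-π T) * h3
      exact (Finset.sum_congr rfl this).trans (by rw [← Finset.sum_div, hstat T' hT']))
    have hpi : ∀ T ∈ S, π T = c * μ T := fun T hT => (div_eq_iff (hμ T hT).ne').1 (hc T hT)
    have e := Finset.sum_congr (rfl : S = S) hpi
    rw [e, ← Finset.mul_sum] at hπ1
    intro T hT
    rw [hpi T hT, eq_div_iff hM.ne']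
    linear_combination μ T * hπ1
end

section
/- Let I and J be finite index sets, x : J → ℝ, C : I × J → ℝ, α, β ∈ ℝ, and A > 0. Consider the entropy functional E(Λ) = − Σ_{i,j} Λ_{ij} (log Λ_{ij} − α x_j + β C_{ij}) on the set of Λ : I × J → ℝ_{>0} with Σ_{i,j} Λ_{ij} = A. Then E attains its unique maximum on this set at the totally constrained spatial interaction model Λ*_{ij} = A · exp(α x_j − β C_{ij}) / Σ_{k,m} exp(α x_m − β C_{km}). -/
open Real

/-- **The totally constrained spatial interaction model maximizes entropy.** On the set
of positive intensities `Λ : I × J → ℝ` with grand total `A`, the entropy functional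
`E(Λ) = −∑ Λ_{ij} (log Λ_{ij} − α x_j + β C_{ij})` attains its unique maximum at
`Λ*_{ij} = A exp(α x_j − β C_{ij}) / ∑_{k,m} exp(α x_m − β C_{km})`. -/
theorem totally_constrained_sim_maximizes_entropy
    {I J : Type*} [Fintype I] [Fintype J] [Nonempty I] [Nonempty J]
    (x : J → ℝ) (C : I × J → ℝ) (α β A : ℝ) (hA : 0 < A)
    (Λstar : I × J → ℝ)
    (hΛstar : ∀ p : I × J,
      Λstar p = A * exp (α * x p.2 - β * C p) / ∑ q, exp (α * x q.2 - β * C q)) :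
    (∀ p, 0 < Λstar p) ∧ (∑ p, Λstar p = A) ∧
    ∀ Λ : I × J → ℝ, (∀ p, 0 < Λ p) → (∑ p, Λ p = A) → Λ ≠ Λstar →
      -(∑ p, Λ p * (log (Λ p) - α * x p.2 + β * C p)) <
        -(∑ p, Λstar p * (log (Λstar p) - α * x p.2 + β * C p)) := by
  have hZ : 0 < ∑ q : I × J, exp (α * x q.2 - β * C q) :=
    Finset.sum_pos (fun _ _ => exp_pos _) Finset.univ_nonempty
  have hpos : ∀ p, 0 < Λstar p := fun p => by
    rw [hΛstar p]
    exact div_pos (mul_pos hA (exp_pos _)) hZ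
  have hsum : ∑ p, Λstar p = A := by
    simp_rw [hΛstar]
    rw [← Finset.sum_div, ← Finset.mul_sum]
    exact mul_div_cancel_right₀ A hZ.ne'
  refine ⟨hpos, hsum, ?_⟩
  intro Λ hΛ hS hne
  set Z := ∑ q : I × J, exp (α * x q.2 - β * C q) with hZdef
  have hlog : ∀ p, log (Λstar p) = log A + (α * x p.2 - β * C p) - log Z := fun p => by
    rw [hΛstar p, log_div (mul_pos hA (exp_pos _)).ne' hZ.ne',
      log_mul hA.ne' (exp_pos _).ne', log_exp]
  -- the value at the optimum
  have hopt : ∑ p, Λstar p * (log (Λstar p) - α * x p.2 + β * C p) = A * (log A - log Z) := by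
    rw [← hsum, Finset.sum_mul, hsum]
    refine Finset.sum_congr rfl fun p _ => ?_
    rw [hlog p]
    ring
  -- strict Gibbs inequality, termwise
  have hstrict : ∀ p, Λ p ≠ Λstar p →
      Λ p * (log A - log Z) + (Λ p - Λstar p) <
        Λ p * (log (Λ p) - α * x p.2 + β * C p) := fun p hp => by
    have h1 : Λstar p / Λ p ≠ 1 := fun h => hp ((div_eq_one_iff_eq (hΛ p).ne').1 h).symm
    have h2 := log_lt_sub_one_of_pos (div_pos (hpos p) (hΛ p)) h1
    rw [log_div (hpos p).ne' (hΛ p).ne', hlog p] at h2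
    have h3 := mul_lt_mul_of_pos_left h2 (hΛ p)
    have h4 : Λ p * (Λstar p / Λ p - 1) = Λstar p - Λ p := by
      have := (hΛ p).ne'
      field_simp
    rw [h4] at h3
    linarith
  have hle : ∀ p, Λ p * (log A - log Z) + (Λ p - Λstar p) ≤
        Λ p * (log (Λ p) - α * x p.2 + β * C p) := fun p => by
    by_cases hp : Λ p = Λstar p
    · rw [hp, hlog p]
      apply le_of_eq
      ring
    · exact (hstrict p hp).le
  obtain ⟨p₀, hp₀⟩ := Function.ne_iff.1 hne
  have hlt := Finset.sum_lt_sum (fun p (_ : p ∈ Finset.univ) => hle p)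
    ⟨p₀, Finset.mem_univ p₀, hstrict p₀ hp₀⟩
  rw [Finset.sum_add_distrib, ← Finset.sum_mul, Finset.sum_sub_distrib, hS, hsum] at hlt
  rw [hopt]
  linarith
end

section
/- Let I and J be finite index sets, x : J → ℝ, C : I × J → ℝ, α, β ∈ ℝ, and let r : I → ℝ_{>0} be fixed row sums. Consider the entropy functional E(Λ) = − Σ_{i,j} Λ_{ij} (log Λ_{ij} − α x_j + β C_{ij}) on the set of Λ : I × J → ℝ_{>0} with Σ_j Λ_{ij} = r_i for every i ∈ I. Then E attains its unique maximum on this set at the singly (production) constrained spatial interaction model Λ*_{ij} = r_i · exp(α x_j − β C_{ij}) / Σ_m exp(α x_m − β C_{im}). -/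
open Real

/-- **The singly (production) constrained spatial interaction model maximizes
entropy.** On the set of positive intensities `Λ : I × J → ℝ` with fixed row sums
`∑_j Λ_{ij} = r_i > 0`, the entropy functional
`E(Λ) = −∑ Λ_{ij} (log Λ_{ij} − α x_j + β C_{ij})` attains its unique maximum at
`Λ*_{ij} = r_i exp(α x_j − β C_{ij}) / ∑_m exp(α x_m − β C_{im})`. -/
theorem singly_constrained_sim_maximizes_entropy
    {I J : Type*} [Fintype I] [Fintype J] [Nonempty J]
    (x : J → ℝ) (C : I × J → ℝ) (α β : ℝ)
    (r : I → ℝ) (hr : ∀ i, 0 < r i)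
    (Λstar : I × J → ℝ)
    (hΛstar : ∀ p : I × J,
      Λstar p = r p.1 * exp (α * x p.2 - β * C p) /
        ∑ m, exp (α * x m - β * C (p.1, m))) :
    (∀ p, 0 < Λstar p) ∧ (∀ i, ∑ j, Λstar (i, j) = r i) ∧
    ∀ Λ : I × J → ℝ, (∀ p, 0 < Λ p) → (∀ i, ∑ j, Λ (i, j) = r i) → Λ ≠ Λstar →
      -(∑ p, Λ p * (log (Λ p) - α * x p.2 + β * C p)) <
        -(∑ p, Λstar p * (log (Λstar p) - α * x p.2 + β * C p)) := by
  have hZ : ∀ i, 0 < ∑ m, exp (α * x m - β * C (i, m)) := fun i =>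
    Finset.sum_pos (fun m _ => exp_pos _) Finset.univ_nonempty
  have hpos : ∀ p, 0 < Λstar p := fun p => by
    rw [hΛstar]
    exact div_pos (mul_pos (hr _) (exp_pos _)) (hZ _)
  have hrow : ∀ i, ∑ j, Λstar (i, j) = r i := fun i => by
    simp only [hΛstar]
    rw [← Finset.sum_div, ← Finset.mul_sum]
    exact mul_div_cancel_right₀ _ (hZ i).ne'
  refine ⟨hpos, hrow, ?_⟩
  intro Λ hΛ hΛr hne
  obtain ⟨k, hk⟩ : ∃ k : I → ℝ, ∀ p, log (Λstar p) = k p.1 + (α * x p.2 - β * C p) := by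
    refine ⟨fun i => log (r i) - log (∑ m, exp (α * x m - β * C (i, m))), fun p => ?_⟩
    rw [hΛstar, log_div (mul_pos (hr _) (exp_pos _)).ne' (hZ _).ne',
      log_mul (hr _).ne' (exp_pos _).ne', log_exp]
    ring
  have hsum : ∀ M : I × J → ℝ, (∀ i, ∑ j, M (i, j) = r i) →
      ∑ p, M p * k p.1 = ∑ i, r i * k i ∧ ∑ p, M p = ∑ i, r i := by
    intro M hM
    constructor
    · rw [Fintype.sum_prod_type]
      refine Finset.sum_congr rfl fun i _ => ?_
      rw [← hM i, Finset.sum_mul]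
    · rw [Fintype.sum_prod_type]
      exact Finset.sum_congr rfl fun i _ => hM i
  have hstar : ∑ p, Λstar p * (log (Λstar p) - α * x p.2 + β * C p) = ∑ i, r i * k i := by
    rw [← (hsum Λstar hrow).1]
    refine Finset.sum_congr rfl fun p _ => ?_
    rw [hk]
    ring
  have hstrict : ∀ p, Λ p ≠ Λstar p → Λ p * k p.1 + Λ p - Λstar p <
      Λ p * (log (Λ p) - α * x p.2 + β * C p) := by
    intro p hp
    have h1 := log_lt_sub_one_of_pos (div_pos (hpos p) (hΛ p))
      (fun h => hp ((div_eq_one_iff_eq (hΛ p).ne').1 h).symm)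
    rw [log_div (hpos p).ne' (hΛ p).ne', hk] at h1
    have h2 := mul_lt_mul_of_pos_left h1 (hΛ p)
    have h3 : Λ p * (Λstar p / Λ p - 1) = Λstar p - Λ p := by
      have := (hΛ p).ne'
      field_simp
    rw [h3] at h2
    linarith
  have hlt : ∑ p, (Λ p * k p.1 + Λ p - Λstar p) <
      ∑ p, Λ p * (log (Λ p) - α * x p.2 + β * C p) := by
    obtain ⟨q, hq⟩ := Function.ne_iff.1 hne
    refine Finset.sum_lt_sum (fun p _ => ?_) ⟨q, Finset.mem_univ _, hstrict q hq⟩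
    by_cases hp : Λ p = Λstar p
    · have : k p.1 = log (Λ p) - α * x p.2 + β * C p := by
        rw [hp, hk]
        ring
      rw [← this, hp]
      linarith
    · exact (hstrict p hp).le
  rw [Finset.sum_sub_distrib, Finset.sum_add_distrib, (hsum Λ hΛr).1, (hsum Λ hΛr).2,
    (hsum Λstar hrow).2] at hlt
  rw [hstar]
  linarith
end
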